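/- Set C(0)=0. For 1≤n≤57, C(n)=C(n−1). For n≥58, let m be the unique integer with t_{m-1}+2t_{m-4} ≤ n < t_m+2t_{m-3} (necessarily m≥7); then C(n)−C(n−1)=1 if n ≤ t_{m-1}+k_{m+1}−2, and C(n)=C(n−1) otherwise. -/

import Mathlib

/-- The three-letter alphabet of the Tribonacci word. -/
inductive TLetter : Type
  | a | b | c
deriving DecidableEq

/-- The Tribonacci substitution σ(a)=ab, σ(b)=ac, σ(c)=a. -/
def tsubst : TLetter → List TLetter
  | .a => [.a, .b]
  | .b => [.a, .c]
  | .c => [.a]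

/-- `Tword m = σ^m(a)`, the m-th finite Tribonacci word. -/
def Tword : ℕ → List TLetter
  | 0 => [.a]
  | n + 1 => (Tword n).flatMap tsubst

/-- The prefix 𝕋[1,n] of the Tribonacci word of length n
(each `Tword n` is a prefix of the next and has length ≥ n). -/
def TPrefix (n : ℕ) : List TLetter := (Tword n).take n

/-- A word is a factor of the Tribonacci word 𝕋. -/
def IsFactorT (w : List TLetter) : Prop := ∃ m, w <:+: Tword m

/-- `tribAux i = t_{i-2}`: Tribonacci numbers, shifted so that the index is a natural. -/
def tribAux : ℕ → ℕ
  | 0 => 0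
  | 1 => 1
  | 2 => 1
  | n + 3 => tribAux (n + 2) + tribAux (n + 1) + tribAux n

/-- The Tribonacci numbers `t m` for `m : ℤ`: t₋₂=0, t₋₁=1, t₀=1,
`t m = t (m-1) + t (m-2) + t (m-3)` for m ≥ 1. (Junk value 0 below -2.) -/
def t (m : ℤ) : ℕ := tribAux (m + 2).toNat

/-- Kernel numbers: k₀=0, k₁=k₂=1, `k m = k (m-1) + k (m-2) + k (m-3) - 1` for m ≥ 3. -/
def kAux : ℕ → ℕ
  | 0 => 0
  | 1 => 1
  | 2 => 1
  | n + 3 => kAux (n + 2) + kAux (n + 1) + kAux n - 1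

def kker (m : ℤ) : ℕ := kAux m.toNat

/-- `A n`: the number of distinct nonempty words w with ww a factor of 𝕋[1,n]. -/
noncomputable def A (n : ℕ) : ℕ := Nat.card {w : List TLetter // w ≠ [] ∧ (w ++ w) <:+: TPrefix n}

/-- `B n`: the number of occurrences of squares in 𝕋[1,n], i.e. of pairs (w,i) with
w nonempty, i ≥ 1, ww occurring in 𝕋 at position i and i + 2|w| - 1 ≤ n. -/
noncomputable def B (n : ℕ) : ℕ :=
  Nat.card {p : List TLetter × ℕ // p.1 ≠ [] ∧ 1 ≤ p.2 ∧
    p.2 + 2 * p.1.length - 1 ≤ n ∧ (p.1 ++ p.1) <+: (TPrefix n).drop (p.2 - 1)}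

/-- `C n`: the number of distinct nonempty words w with www a factor of 𝕋[1,n]. -/
noncomputable def C (n : ℕ) : ℕ := Nat.card {w : List TLetter // w ≠ [] ∧ (w ++ w ++ w) <:+: TPrefix n}

/-- `D n`: the number of occurrences of cubes in 𝕋[1,n], i.e. of pairs (w,i) with
w nonempty, i ≥ 1, www occurring in 𝕋 at position i and i + 3|w| - 1 ≤ n. -/
noncomputable def D (n : ℕ) : ℕ :=
  Nat.card {p : List TLetter × ℕ // p.1 ≠ [] ∧ 1 ≤ p.2 ∧
    p.2 + 3 * p.1.length - 1 ≤ n ∧ (p.1 ++ p.1 ++ p.1) <+: (TPrefix n).drop (p.2 - 1)}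

/-! ### The infinite Tribonacci word -/

/-- The letter of the infinite Tribonacci word at the (zero-based) position `n`. -/
def tribLetter (n : ℕ) : TLetter := (Tword n).getD n .a

/-- The factor of length `l` of the Tribonacci word starting at the position `s`. -/
def tribFactor (s l : ℕ) : List TLetter := (List.range l).map fun j => tribLetter (s + j)

/-- The position at which the image of the `n`-th letter under the substitution starts. -/
def imagePos : ℕ → ℕ
  | 0 => 0
  | n + 1 => imagePos n + (tsubst (tribLetter n)).length

/-- The letter at distance `p` agrees with the letter at every position in `[s, e)`. -/
def Matches (p s e : ℕ) : Prop := ∀ i, s ≤ i → i < e → tribLetter i = tribLetter (i + p)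

theorem Tword_add_three (m : ℕ) : Tword (m + 3) = Tword (m + 2) ++ Tword (m + 1) ++ Tword m := by
  induction m with
  | zero => decide
  | succ m ih =>
    refine (congrArg (List.flatMap tsubst) ih).trans ?_
    rw [List.flatMap_append, List.flatMap_append]
    rfl

theorem length_Tword (m : ℕ) : (Tword m).length = tribAux (m + 2) := by
  induction m using Nat.strong_induction_on with
  | _ m ih =>
    match m with
    | 0 => decide
    | 1 => decide
    | 2 => decide
    | m + 3 =>
      rw [Tword_add_three, List.length_append, List.length_append, ih _ (by omega),
        ih _ (by omega), ih _ (by omega)]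
      rfl

theorem tribAux_add_three (n : ℕ) :
    tribAux (n + 3) = tribAux (n + 2) + tribAux (n + 1) + tribAux n := rfl

theorem lt_tribAux_add_two (m : ℕ) : m < tribAux (m + 2) := by
  induction m using Nat.strong_induction_on with
  | _ m ih =>
    match m with
    | 0 => decide
    | 1 => decide
    | 2 => decide
    | m + 3 =>
      have h1 := ih (m + 2) (by omega)
      have h2 := ih (m + 1) (by omega)
      have := tribAux_add_three (m + 2)
      simp only [Nat.add_assoc, Nat.reduceAdd] at *
      omega

theorem tribAux_mono : Monotone tribAux := by
  refine monotone_nat_of_le_succ fun n => ?_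
  match n with
  | 0 => decide
  | 1 => decide
  | n + 2 => rw [tribAux_add_three]; omega

theorem tribAux_lt_succ (n : ℕ) : tribAux (n + 2) < tribAux (n + 3) := by
  have h : tribAux 1 ≤ tribAux (n + 1) := tribAux_mono (by omega)
  rw [tribAux_add_three]
  have : tribAux 1 = 1 := rfl
  omega

theorem tribAux_add_two_strictMono : StrictMono fun k => tribAux (k + 2) :=
  strictMono_nat_of_lt_succ tribAux_lt_succ

theorem Tword_prefix_succ (m : ℕ) : Tword m <+: Tword (m + 1) := by
  induction m with
  | zero => exact ⟨[.b], rfl⟩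
  | succ m ih =>
    obtain ⟨r, hr⟩ := ih
    exact ⟨r.flatMap tsubst, by rw [Tword, ← List.flatMap_append, hr]; rfl⟩

theorem Tword_prefix {m n : ℕ} (h : m ≤ n) : Tword m <+: Tword n := by
  induction n, h using Nat.le_induction with
  | base => exact List.prefix_rfl
  | succ n _ ih => exact ih.trans (Tword_prefix_succ n)

theorem getElem_Tword {m i : ℕ} (h : i < (Tword m).length) : (Tword m)[i] = tribLetter i := by
  have hi : i < (Tword i).length := by rw [length_Tword]; exact lt_tribAux_add_two i
  rw [tribLetter, List.getD_eq_getElem _ _ hi]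
  rcases le_total m i with hm | hm
  · exact (Tword_prefix hm).getElem h
  · exact ((Tword_prefix hm).getElem hi).symm

theorem length_tribFactor (s l : ℕ) : (tribFactor s l).length = l := by simp [tribFactor]

theorem tribFactor_add (s l k : ℕ) :
    tribFactor s (l + k) = tribFactor s l ++ tribFactor (s + l) k := by
  simp [tribFactor, List.range_add, Function.comp_def, Nat.add_assoc]

theorem tribFactor_eq_iff {s s' l : ℕ} :
    tribFactor s l = tribFactor s' l ↔ ∀ j < l, tribLetter (s + j) = tribLetter (s' + j) := by
  simp [tribFactor]

theorem take_Tword {m n : ℕ} (h : n ≤ (Tword m).length) : (Tword m).take n = tribFactor 0 n := by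
  apply List.ext_getElem
  · simp [tribFactor, h]
  · intro i h1 h2
    simp [tribFactor, getElem_Tword]

theorem TPrefix_eq_tribFactor (n : ℕ) : TPrefix n = tribFactor 0 n :=
  take_Tword (by rw [length_Tword]; exact (lt_tribAux_add_two n).le)

theorem infix_tribFactor_iff {w : List TLetter} {n : ℕ} :
    w <:+: tribFactor 0 n ↔ ∃ s, s + w.length ≤ n ∧ w = tribFactor s w.length := by
  constructor
  · rintro ⟨x, y, h⟩
    have hl := congrArg List.length h
    simp only [List.length_append, length_tribFactor] at hl
    refine ⟨x.length, by omega, ?_⟩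
    rw [← hl, tribFactor_add, tribFactor_add, Nat.zero_add] at h
    have h1 := (List.append_inj h (by simp [length_tribFactor])).1
    exact (List.append_inj h1 (by simp [length_tribFactor])).2
  · rintro ⟨s, hs, h⟩
    obtain ⟨r, rfl⟩ := Nat.exists_eq_add_of_le hs
    refine ⟨tribFactor 0 s, tribFactor (s + w.length) r, ?_⟩
    rw [tribFactor_add, tribFactor_add, Nat.zero_add, ← h, Nat.zero_add]

/-! ### The action of the substitution on positions -/

theorem flatMap_tribFactor (n : ℕ) :
    (tribFactor 0 n).flatMap tsubst = tribFactor 0 (imagePos n) := by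
  have hlen : ∀ n, ((tribFactor 0 n).flatMap tsubst).length = imagePos n := by
    intro n
    induction n with
    | zero => rfl
    | succ n ih =>
      rw [tribFactor_add, List.flatMap_append, List.length_append, ih, imagePos]
      simp [tribFactor]
  have hn : n ≤ (Tword n).length := by rw [length_Tword]; exact (lt_tribAux_add_two n).le
  have hp : (tribFactor 0 n).flatMap tsubst <+: Tword (n + 1) := by
    refine ⟨((Tword n).drop n).flatMap tsubst, ?_⟩
    rw [← take_Tword hn, ← List.flatMap_append, List.take_append_drop, Tword]
  rw [List.prefix_iff_eq_take.1 hp, hlen, take_Tword]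
  simpa [hlen] using hp.length_le

theorem tsubst_tribLetter (n : ℕ) :
    tsubst (tribLetter n) = tribFactor (imagePos n) (tsubst (tribLetter n)).length := by
  have h := flatMap_tribFactor (n + 1)
  rw [tribFactor_add, List.flatMap_append, flatMap_tribFactor, imagePos, tribFactor_add] at h
  simpa [tribFactor] using List.append_cancel_left h

theorem imagePos_length_Tword (m : ℕ) : imagePos (tribAux (m + 2)) = tribAux (m + 3) := by
  have h := congrArg List.length (flatMap_tribFactor (tribAux (m + 2)))
  rw [length_tribFactor, ← length_Tword, ← take_Tword le_rfl, List.take_length] at h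
  rw [← length_Tword, ← h, ← length_Tword]
  rfl

theorem tribLetter_imagePos (n : ℕ) : tribLetter (imagePos n) = .a := by
  have h := tsubst_tribLetter n
  cases hn : tribLetter n <;> rw [hn] at h <;>
    simp [tsubst, tribFactor, List.range_succ] at h <;> first | exact h.symm | exact h.1.symm

/-- The letter following an `a` which starts the image of a given letter. -/
def letterAfter : TLetter → TLetter
  | .a => .b
  | .b => .c
  | .c => .a

theorem letterAfter_injective : Function.Injective letterAfter := by
  intro x y; cases x <;> cases y <;> simp [letterAfter]

theorem tribLetter_imagePos_add_one (n : ℕ) :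
    tribLetter (imagePos n + 1) = letterAfter (tribLetter n) := by
  have h := tsubst_tribLetter n
  have h' := tribLetter_imagePos (n + 1)
  rw [imagePos] at h'
  cases hn : tribLetter n <;> rw [hn] at h h' <;>
    simp [tsubst, tribFactor, List.range_succ] at h h' <;> simp [letterAfter, h, h']

theorem imagePos_succ (n : ℕ) :
    (tribLetter n = .c ∧ imagePos (n + 1) = imagePos n + 1) ∨
      (tribLetter n ≠ .c ∧ imagePos (n + 1) = imagePos n + 2) := by
  rw [imagePos]
  cases tribLetter n <;> simp [tsubst]

theorem imagePos_succ_congr {m n : ℕ} (h : tribLetter m = tribLetter n) :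
    imagePos (m + 1) + imagePos n = imagePos (n + 1) + imagePos m := by
  rw [imagePos, imagePos, h]; omega

theorem imagePos_strictMono : StrictMono imagePos :=
  strictMono_nat_of_lt_succ fun n => by have := imagePos_succ n; omega

theorem exists_imagePos (i : ℕ) :
    ∃ u, i = imagePos u ∨ (i = imagePos u + 1 ∧ imagePos (u + 1) = i + 1 ∧ tribLetter i ≠ .a) := by
  induction i with
  | zero => exact ⟨0, Or.inl rfl⟩
  | succ i ih =>
    obtain ⟨u, rfl | ⟨h1, h2, -⟩⟩ := ih
    · rcases imagePos_succ u with ⟨-, h⟩ | ⟨h, h'⟩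
      · exact ⟨u + 1, Or.inl h.symm⟩
      · refine ⟨u, Or.inr ⟨rfl, h', ?_⟩⟩
        rw [tribLetter_imagePos_add_one]
        revert h
        cases tribLetter u <;> simp [letterAfter]
    · exact ⟨u + 1, Or.inl h2.symm⟩

theorem exists_imagePos_of_eq_a {i : ℕ} (h : tribLetter i = .a) : ∃ u, i = imagePos u := by
  obtain ⟨u, hu | ⟨-, -, hu⟩⟩ := exists_imagePos i
  exacts [⟨u, hu⟩, absurd h hu]

theorem tribLetter_succ_of_ne_a {i : ℕ} (h : tribLetter i ≠ .a) : tribLetter (i + 1) = .a := by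
  obtain ⟨u, rfl | ⟨-, hu, -⟩⟩ := exists_imagePos i
  · exact absurd (tribLetter_imagePos u) h
  · rw [← hu, tribLetter_imagePos]

theorem not_three_a {i : ℕ} (h0 : tribLetter i = .a) (h1 : tribLetter (i + 1) = .a) :
    tribLetter (i + 2) ≠ .a := by
  intro h2
  obtain ⟨u, rfl⟩ := exists_imagePos_of_eq_a h0
  have hu : tribLetter u = .c := letterAfter_injective (by
    rw [← tribLetter_imagePos_add_one, h1]; rfl)
  have hu' : imagePos (u + 1) = imagePos u + 1 := by
    rcases imagePos_succ u with h | h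
    exacts [h.2, absurd hu h.1]
  have : tribLetter (u + 1) = .c := letterAfter_injective (by
    rw [← tribLetter_imagePos_add_one, hu', h2]; rfl)
  rw [tribLetter_succ_of_ne_a (by simp [hu])] at this
  cases this

/-- A matching interval is mapped by the substitution to a matching interval. -/
theorem Matches.image {q u u' p : ℕ} (h : Matches q u u')
    (hp : imagePos (u + q) = imagePos u + p) :
    (∀ x, u ≤ x → x ≤ u' → imagePos (x + q) = imagePos x + p) ∧
      Matches p (imagePos u) (imagePos u' + 1) := by
  have hpos : ∀ x, u ≤ x → x ≤ u' → imagePos (x + q) = imagePos x + p := by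
    intro x hx
    induction x, hx using Nat.le_induction with
    | base => exact fun _ => hp
    | succ x hx ih =>
      intro hx'
      have h1 := ih (by omega)
      have h2 := imagePos_succ_congr (h x hx (by omega))
      rw [show x + 1 + q = x + q + 1 by omega]
      omega
  refine ⟨hpos, fun i hi hi' => ?_⟩
  obtain ⟨x, rfl | ⟨rfl, h2, -⟩⟩ := exists_imagePos i
  · rw [← hpos x (imagePos_strictMono.le_iff_le.1 hi)
      (imagePos_strictMono.le_iff_le.1 (by omega)), tribLetter_imagePos, tribLetter_imagePos]
  · have hx' : x < u' := imagePos_strictMono.lt_iff_lt.1 (by omega)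
    have hx : u < x + 1 := imagePos_strictMono.lt_iff_lt.1 (by omega)
    rw [show imagePos x + 1 + p = imagePos x + p + 1 by omega,
      ← hpos x (by omega) hx'.le, tribLetter_imagePos_add_one, tribLetter_imagePos_add_one,
      h x (by omega) hx']

/-- A matching interval of length at least two is contained in the image of a matching
interval. -/
theorem Matches.exists_preimage {p s e : ℕ} (h : Matches p s e) (hse : s + 2 ≤ e) :
    ∃ q u u', u ≤ u' ∧ Matches q u u' ∧ imagePos (u + q) = imagePos u + p ∧
      imagePos u ≤ s ∧ e ≤ imagePos u' + 1 := by
  obtain ⟨u, v, hus, hsu, huv⟩ :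
      ∃ u v, imagePos u ≤ s ∧ s ≤ imagePos u + 1 ∧ imagePos v = imagePos u + p := by
    obtain ⟨u, hu | ⟨hu, hu', -⟩⟩ := exists_imagePos s
    · have : tribLetter (s + p) = .a := by
        rw [← h s le_rfl (by omega), hu, tribLetter_imagePos]
      obtain ⟨v, hv⟩ := exists_imagePos_of_eq_a this
      exact ⟨u, v, by omega, by omega, by omega⟩
    · have hs := h s le_rfl (by omega)
      have : tribLetter (s + p) ≠ .a := by
        rw [← hs, hu, tribLetter_imagePos_add_one]
        rcases imagePos_succ u with h | h
        · omega
        · have := h.1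
          revert this
          cases tribLetter u <;> simp [letterAfter]
      obtain ⟨v, hv | ⟨hv, -⟩⟩ := exists_imagePos (s + p)
      · exact absurd (hv ▸ tribLetter_imagePos v) this
      · exact ⟨u, v, by omega, by omega, by omega⟩
  have huv' : u ≤ v := imagePos_strictMono.le_iff_le.1 (by omega)
  obtain ⟨q, rfl⟩ := Nat.exists_eq_add_of_le huv'
  have hex : ∃ i, u ≤ i ∧ e ≤ imagePos i + 1 :=
    ⟨u + e, by omega, by have := imagePos_strictMono.id_le (u + e); simp at this; omega⟩
  classical
  obtain ⟨hu', he⟩ := Nat.find_spec hex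
  have hmin : ∀ i, u ≤ i → i < Nat.find hex → imagePos i + 1 < e := fun i hi hi' => by
    have := Nat.find_min hex hi'
    omega
  have step : ∀ i, u ≤ i → i < Nat.find hex → imagePos (i + q) = imagePos i + p →
      tribLetter i = tribLetter (i + q) := fun i hi hi' hp => by
    have := imagePos_strictMono.monotone hi
    have hm := h (imagePos i + 1) (by omega) (hmin i hi hi')
    rw [show imagePos i + 1 + p = imagePos i + p + 1 by omega, ← hp,
      tribLetter_imagePos_add_one, tribLetter_imagePos_add_one] at hm
    exact letterAfter_injective hm
  have hpos : ∀ i, u ≤ i → i < Nat.find hex → imagePos (i + q) = imagePos i + p := by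
    intro i hi
    induction i, hi using Nat.le_induction with
    | base => exact fun _ => huv
    | succ i hi ih =>
      intro hi'
      have h1 := ih (by omega)
      have h2 := imagePos_succ_congr (step i hi (by omega) h1)
      rw [show i + 1 + q = i + q + 1 by omega]
      omega
  exact ⟨q, u, Nat.find hex, hu', fun i hi hi' => step i hi hi' (hpos i hi hi'), huv, hus, he⟩

/-! ### Classification of long repetitions -/

/-- The length of the matching interval of the repetition with period `t k`. -/
def runLength : ℕ → ℕ
  | 0 => 1
  | k + 1 => runLength k + tribAux (k + 3)

/-- The start of the first long repetition with period `t k`. -/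
def runStart (k : ℕ) : ℕ := tribAux (k + 4) + tribAux (k + 3)

theorem tribAux_le_runLength (k : ℕ) : tribAux (k + 2) ≤ runLength k := by
  cases k with
  | zero => decide
  | succ k => exact Nat.le_add_left _ _

theorem matches_zero_runLength (j : ℕ) :
    Matches (tribAux (j + 3)) 0 (runLength j) ∧ imagePos (runLength j) + 1 = runLength (j + 1) := by
  induction j with
  | zero =>
    refine ⟨fun i _ hi => ?_, by decide⟩
    obtain rfl : i = 0 := by simp only [runLength] at hi; omega
    decide
  | succ j ih =>
    obtain ⟨h1, h2⟩ := ih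
    have hp : imagePos (0 + tribAux (j + 3)) = imagePos 0 + tribAux (j + 4) := by
      rw [Nat.zero_add, imagePos_length_Tword (j + 1)]
      simp [imagePos]
    obtain ⟨h3, h4⟩ := h1.image hp
    have h5 := h3 (runLength j) (Nat.zero_le _) le_rfl
    rw [h2] at h4
    refine ⟨h4, ?_⟩
    rw [show runLength (j + 1) = runLength j + tribAux (j + 3) from rfl, h5,
      show runLength (j + 1 + 1) = runLength (j + 1) + tribAux (j + 4) from rfl]
    omega

theorem imagePos_runStart (k : ℕ) : imagePos (runStart k) = runStart (k + 1) := by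
  have hp : imagePos (0 + tribAux (k + 4)) = imagePos 0 + tribAux (k + 5) := by
    rw [Nat.zero_add, imagePos_length_Tword (k + 2)]
    simp [imagePos]
  have h := ((matches_zero_runLength (k + 1)).1.image hp).1 (tribAux (k + 3))
    (Nat.zero_le _) (tribAux_le_runLength (k + 1))
  rw [imagePos_length_Tword (k + 1)] at h
  rw [runStart, runStart, Nat.add_comm, h, Nat.add_comm]

theorem imagePos_runStart_add_runLength (k : ℕ) :
    imagePos (runStart k + runLength k) + 1 = runStart (k + 1) + runLength (k + 1) := by
  have hp (k : ℕ) : imagePos (0 + runStart k) = imagePos 0 + runStart (k + 1) := by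
    rw [Nat.zero_add, imagePos_runStart]
    simp [imagePos]
  have h : Matches (runStart k) 0 (runLength k) := by
    induction k with
    | zero =>
      intro i _ hi
      obtain rfl : i = 0 := by simp only [runLength] at hi; omega
      decide
    | succ k ih =>
      have := (ih.image (hp k)).2
      rwa [(matches_zero_runLength k).2] at this
  have h1 := (h.image (hp k)).1 (runLength k) (Nat.zero_le _) le_rfl
  have h2 := (matches_zero_runLength k).2
  rw [Nat.add_comm (runStart k), h1]
  omega

theorem runStart_add_tribAux (k : ℕ) : runStart k + tribAux (k + 2) = tribAux (k + 5) := rfl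

theorem imagePos_runStart_add_tribAux (k : ℕ) :
    imagePos (runStart k + tribAux (k + 2)) = imagePos (runStart k) + tribAux (k + 3) := by
  rw [runStart_add_tribAux, imagePos_length_Tword (k + 3), imagePos_runStart,
    ← runStart_add_tribAux (k + 1)]

/-- The first long repetition with period `t k`. -/
theorem matches_run (k : ℕ) :
    Matches (tribAux (k + 2)) (runStart k) (runStart k + runLength k) := by
  induction k with
  | zero =>
    intro i hi hi'
    have h6 : runStart 0 = 6 := by decide
    obtain rfl : i = 6 := by simp only [runLength] at hi'; omega
    decide
  | succ k ih =>
    have := (ih.image (imagePos_runStart_add_tribAux k)).2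
    rwa [imagePos_runStart, imagePos_runStart_add_runLength] at this

/-- Every long repetition is part of a translate of the first one with the same period. -/
theorem Matches.classify {p s e : ℕ} (hp : 1 ≤ p) (h : Matches p s e) (hse : s + 2 * p ≤ e + 1) :
    ∃ k δ, p = tribAux (k + 2) ∧ runStart k + δ ≤ s ∧ e ≤ runStart k + runLength k + δ ∧
      Matches δ (runStart k) (runStart k + runLength k + tribAux (k + 2)) := by
  induction p using Nat.strong_induction_on generalizing s e with
  | _ p ih =>
    rcases Nat.lt_or_ge 1 p with hp2 | hp1
    · obtain ⟨q, u, u', huu, hm, hq, hus, hue⟩ := h.exists_preimage (by omega)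
      have hq1 : 1 ≤ q := by
        rcases Nat.eq_zero_or_pos q with rfl | hq0
        · simp at hq; omega
        · exact hq0
      have hcc : ∀ x, imagePos x + 3 ≤ imagePos (x + 2) := fun x => by
        have h1 := imagePos_succ x
        have h2 := imagePos_succ (x + 1)
        simp only [Nat.add_assoc, Nat.reduceAdd] at h2
        rcases h1 with h1 | h1
        · have := tribLetter_succ_of_ne_a (i := x) (by simp [h1.1])
          rw [this] at h2
          simp at h2
          omega
        · omega
      have hqp : q < p := by
        rcases Nat.lt_or_ge q 2 with hq2 | hq2
        · omega
        · obtain ⟨r, rfl⟩ := Nat.exists_eq_add_of_le hq2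
          have h1 := hcc u
          have h2 := imagePos_strictMono.add_le_nat r (u + 2)
          rw [show u + (2 + r) = r + (u + 2) by omega] at hq
          omega
      have hlen : u + 2 * q ≤ u' + 1 := by
        by_contra! hlt
        rcases Nat.lt_or_ge u' (u + q) with hu' | hu'
        · have := imagePos_strictMono hu'
          omega
        · obtain ⟨x, rfl⟩ := Nat.exists_eq_add_of_le' hu'
          have h1 := (hm.image hq).1 (x + u) (by omega) (by omega)
          have h2 := hcc (x + u)
          have h3 : imagePos (x + u + 2) ≤ imagePos (u + q) :=
            imagePos_strictMono.monotone (by omega)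
          rw [show x + (u + q) = x + u + q by omega] at hue
          omega
      obtain ⟨k, δ, rfl, hs, he, hδ⟩ := ih q hqp hq1 hm hlen
      have hmono : imagePos (runStart k) ≤ imagePos (runStart k + δ) :=
        imagePos_strictMono.monotone (by omega)
      obtain ⟨δ', hδ'⟩ := Nat.exists_eq_add_of_le hmono
      obtain ⟨hpos, him⟩ := hδ.image hδ'
      obtain ⟨hpos', -⟩ := (matches_run k).image (imagePos_runStart_add_tribAux k)
      have hend : imagePos (runStart k + runLength k + tribAux (k + 2)) + 1 =
          runStart (k + 1) + runLength (k + 1) + tribAux (k + 3) := by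
        rw [hpos' _ (by omega) le_rfl, ← imagePos_runStart_add_runLength]
        omega
      rw [hend, imagePos_runStart] at him
      refine ⟨k + 1, δ', ?_, ?_, ?_, him⟩
      · obtain ⟨x, rfl⟩ := Nat.exists_eq_add_of_le' (show δ ≤ u by omega)
        have h1 := hpos x (by omega) (by omega)
        have h2 := hpos (x + tribAux (k + 2)) (by omega) (by omega)
        have h3 := hpos' x (by omega) (by omega)
        rw [show x + δ + tribAux (k + 2) = x + tribAux (k + 2) + δ by omega] at hq
        rw [show k + 1 + 2 = k + 3 from rfl]
        omega
      · rw [← imagePos_runStart, ← hδ']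
        exact (imagePos_strictMono.monotone hs).trans hus
      · have h1 := imagePos_strictMono.monotone he
        rw [hpos _ (by omega) (by omega)] at h1
        rw [← imagePos_runStart_add_runLength]
        omega
    · obtain rfl : p = 1 := by omega
      have h0 := h s le_rfl (by omega)
      have ha : tribLetter s = .a := by
        by_contra hne
        rw [tribLetter_succ_of_ne_a hne] at h0
        exact hne h0
      have ha' : tribLetter (s + 1) = .a := h0 ▸ ha
      have he : e ≤ s + 1 := by
        by_contra! hlt
        have := h (s + 1) (by omega) (by omega)
        exact not_three_a ha ha' (this ▸ ha')
      have hs : 6 ≤ s := by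
        by_contra! hlt
        have : ∀ s < 6, ¬(tribLetter s = .a ∧ tribLetter (s + 1) = .a) := by decide
        exact this s hlt ⟨ha, ha'⟩
      have h6 : runStart 0 = 6 := by decide
      have h1 : runLength 0 = 1 := rfl
      have h2 : tribAux (0 + 2) = 1 := rfl
      refine ⟨0, s - 6, rfl, by omega, by omega, fun i hi hi' => ?_⟩
      obtain rfl | rfl : i = 6 ∨ i = 7 := by omega
      · rw [show 6 + (s - 6) = s by omega, ha]; decide
      · rw [show 7 + (s - 6) = s + 1 by omega, ha']; decide

/-! ### Numerical facts -/

theorem runLength_add_three (k : ℕ) :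
    runLength (k + 3) = runLength (k + 2) + runLength (k + 1) + runLength k + 3 := by
  induction k with
  | zero => decide
  | succ k ih =>
    have := tribAux_add_three (k + 3)
    simp only [runLength, Nat.add_assoc, Nat.reduceAdd] at *
    omega

theorem kAux_eq_runLength_add_two (k : ℕ) : kAux (k + 5) = runLength k + 2 := by
  induction k using Nat.strong_induction_on with
  | _ k ih =>
    match k with
    | 0 => decide
    | 1 => decide
    | 2 => decide
    | k + 3 =>
      rw [show k + 3 + 5 = k + 5 + 3 from rfl, kAux, show k + 5 + 2 = k + 2 + 5 from rfl,
        show k + 5 + 1 = k + 1 + 5 from rfl, ih _ (by omega), ih _ (by omega), ih _ (by omega),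
        runLength_add_three]
      omega

theorem runLength_add_two_le (k : ℕ) : runLength k + 2 ≤ 3 * tribAux (k + 2) := by
  induction k using Nat.strong_induction_on with
  | _ k ih =>
    match k with
    | 0 => decide
    | 1 => decide
    | 2 => decide
    | k + 3 =>
      have h1 := ih k (by omega)
      have h2 := ih (k + 1) (by omega)
      have h3 := ih (k + 2) (by omega)
      have h4 := runLength_add_three k
      have h5 := tribAux_add_three (k + 2)
      simp only [Nat.add_assoc, Nat.reduceAdd] at *
      omega

theorem three_mul_runLength_add_five_le (k : ℕ) :
    3 * runLength (k + 4) + 5 ≤ 7 * tribAux (k + 6) := by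
  induction k using Nat.strong_induction_on with
  | _ k ih =>
    match k with
    | 0 => decide
    | 1 => decide
    | 2 => decide
    | k + 3 =>
      have h1 := ih k (by omega)
      have h2 := ih (k + 1) (by omega)
      have h3 := ih (k + 2) (by omega)
      have h4 := runLength_add_three (k + 4)
      have h5 := tribAux_add_three (k + 6)
      simp only [Nat.add_assoc, Nat.reduceAdd] at *
      omega

theorem three_mul_runLength_le {k : ℕ} (hk : 3 ≤ k) :
    3 * runLength k ≤ 7 * tribAux (k + 2) := by
  match k with
  | 3 => decide
  | k + 4 =>
    have := three_mul_runLength_add_five_le k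
    rw [show k + 4 + 2 = k + 6 from rfl]
    omega

theorem three_le_of_two_mul_le_runLength {k : ℕ} (h : 2 * tribAux (k + 2) ≤ runLength k) :
    3 ≤ k := by
  by_contra! hk
  have : ∀ k < 3, ¬2 * tribAux (k + 2) ≤ runLength k := by decide
  exact this k hk h

/-! ### Cubes in prefixes -/

/-- The roots of the cubes occurring in the prefix of length `n`. -/
def cubeRoots (n : ℕ) : Set (List TLetter) := {w | w ≠ [] ∧ (w ++ w ++ w) <:+: TPrefix n}

theorem C_eq_ncard (n : ℕ) : C n = (cubeRoots n).ncard := rfl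

theorem mem_cubeRoots_iff {w : List TLetter} {n : ℕ} :
    w ∈ cubeRoots n ↔ 1 ≤ w.length ∧ ∃ s, s + 3 * w.length ≤ n ∧ w = tribFactor s w.length ∧
      Matches w.length s (s + 2 * w.length) := by
  have hcube (s : ℕ) : w ++ w ++ w = tribFactor s (w ++ w ++ w).length ↔
      w = tribFactor s w.length ∧ Matches w.length s (s + 2 * w.length) := by
    rw [List.length_append, List.length_append, tribFactor_add, tribFactor_add]
    constructor
    · intro h
      obtain ⟨h12, h3⟩ := List.append_inj h (by simp [length_tribFactor])
      obtain ⟨h1, h2⟩ := List.append_inj h12 (by simp [length_tribFactor])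
      refine ⟨h1, fun i hi hi' => ?_⟩
      have h12 := tribFactor_eq_iff.1 (h1.symm.trans h2)
      have h23 := tribFactor_eq_iff.1 (h2.symm.trans h3)
      rcases Nat.lt_or_ge i (s + w.length) with hlt | hge
      · have := h12 (i - s) (by omega)
        rwa [show s + (i - s) = i by omega, show s + w.length + (i - s) = i + w.length by omega]
          at this
      · have := h23 (i - s - w.length) (by omega)
        rwa [show s + w.length + (i - s - w.length) = i by omega,
          show s + (w.length + w.length) + (i - s - w.length) = i + w.length by omega] at this
    · rintro ⟨h1, hm⟩
      have h12 : tribFactor s w.length = tribFactor (s + w.length) w.length :=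
        tribFactor_eq_iff.2 fun j hj => by
          rw [hm (s + j) (by omega) (by omega)]; congr 1; omega
      have h23 : tribFactor (s + w.length) w.length =
          tribFactor (s + (w.length + w.length)) w.length :=
        tribFactor_eq_iff.2 fun j hj => by
          rw [hm (s + w.length + j) (by omega) (by omega)]; congr 1; omega
      rw [← h23, ← h12, ← h1]
  rw [cubeRoots, Set.mem_ofPred_eq, TPrefix_eq_tribFactor, infix_tribFactor_iff,
    ← List.length_pos_iff]
  refine and_congr Iff.rfl (exists_congr fun s => and_congr ?_ (hcube s))
  simp only [List.length_append]
  omega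

theorem cubeRoots_mono : Monotone cubeRoots := by
  intro m n hmn w hw
  rw [mem_cubeRoots_iff] at hw ⊢
  obtain ⟨h1, s, hs, h⟩ := hw
  exact ⟨h1, s, hs.trans hmn, h⟩

theorem finite_cubeRoots (n : ℕ) : (cubeRoots n).Finite := by
  refine (((Set.finite_Iic n).prod (Set.finite_Iic n)).image
    fun x => tribFactor x.1 x.2).subset fun w hw => ?_
  obtain ⟨-, s, hs, h, -⟩ := mem_cubeRoots_iff.1 hw
  exact ⟨(s, w.length), ⟨by simp; omega, by simp; omega⟩, h.symm⟩

/-- Every cube is a translate of a cube inside the first long repetition with the same period. -/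
theorem exists_run_of_mem_cubeRoots {w : List TLetter} {n : ℕ} (hw : w ∈ cubeRoots n) :
    ∃ k s, w.length = tribAux (k + 2) ∧ runStart k ≤ s ∧ s + 3 * tribAux (k + 2) ≤ n ∧
      s + 2 * tribAux (k + 2) ≤ runStart k + runLength k ∧ w = tribFactor s (tribAux (k + 2)) := by
  obtain ⟨h1, s, hs, hw, hm⟩ := mem_cubeRoots_iff.1 hw
  obtain ⟨k, δ, hk, hsk, hek, hδ⟩ := hm.classify h1 (by omega)
  rw [hk] at hs hw hek
  refine ⟨k, s - δ, hk, by omega, by omega, by omega, hw.trans (tribFactor_eq_iff.2 fun j hj => ?_)⟩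
  rw [hδ (s - δ + j) (by omega) (by omega)]
  congr 1
  omega

theorem tribFactor_mem_cubeRoots {k s n : ℕ} (h1 : runStart k ≤ s)
    (h2 : s + 2 * tribAux (k + 2) ≤ runStart k + runLength k) (h3 : s + 3 * tribAux (k + 2) ≤ n) :
    tribFactor s (tribAux (k + 2)) ∈ cubeRoots n := by
  rw [mem_cubeRoots_iff, length_tribFactor]
  have := lt_tribAux_add_two k
  exact ⟨by omega, s, h3, rfl, fun i hi hi' => matches_run k i (by omega) (by omega)⟩

/-- The cubes inside the first long repetition with a given period are distinct. -/
theorem tribFactor_ne_of_lt {k s s' : ℕ} (h1 : runStart k ≤ s) (hlt : s < s')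
    (h2 : s' + 2 * tribAux (k + 2) ≤ runStart k + runLength k) :
    tribFactor s (tribAux (k + 2)) ≠ tribFactor s' (tribAux (k + 2)) := by
  intro heq
  have hk := three_mul_runLength_le (three_le_of_two_mul_le_runLength (k := k) (by omega))
  have hm : Matches (s' - s) s (s + tribAux (k + 2)) := fun i hi hi' => by
    have := tribFactor_eq_iff.1 heq (i - s) (by omega)
    rwa [show s + (i - s) = i by omega, show s' + (i - s) = i + (s' - s) by omega] at this
  obtain ⟨k', δ, hk', hs, he, -⟩ := hm.classify (by omega) (by omega)
  have := runLength_add_two_le k'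
  omega

theorem C_eq_of_forall {n : ℕ}
    (h : ∀ k, ¬(runStart k + 3 * tribAux (k + 2) ≤ n ∧
      n ≤ runStart k + runLength k + tribAux (k + 2))) : C n = C (n - 1) := by
  rw [C_eq_ncard, C_eq_ncard]
  congr 1
  refine Set.Subset.antisymm (fun w hw => ?_) (cubeRoots_mono (Nat.sub_le n 1))
  obtain ⟨k, s, -, hs, hn, he, rfl⟩ := exists_run_of_mem_cubeRoots hw
  refine tribFactor_mem_cubeRoots hs he ?_
  have := h k
  omega

theorem C_eq_add_one {n k : ℕ} (h1 : runStart k + 3 * tribAux (k + 2) ≤ n)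
    (h2 : n ≤ runStart k + runLength k + tribAux (k + 2))
    (huniq : ∀ k', runStart k' + 3 * tribAux (k' + 2) ≤ n →
      n ≤ runStart k' + runLength k' + tribAux (k' + 2) → k' = k) : C n = C (n - 1) + 1 := by
  obtain ⟨s, rfl⟩ := Nat.exists_eq_add_of_le' (show 3 * tribAux (k + 2) ≤ n by omega)
  have hpos := lt_tribAux_add_two k
  rw [C_eq_ncard, C_eq_ncard]
  have hnot : tribFactor s (tribAux (k + 2)) ∉ cubeRoots (s + 3 * tribAux (k + 2) - 1) := by
    intro hmem
    obtain ⟨k', s', hl, hs, hn, he, heq⟩ := exists_run_of_mem_cubeRoots hmem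
    rw [length_tribFactor] at hl
    obtain rfl : k = k' := tribAux_add_two_strictMono.injective hl
    exact tribFactor_ne_of_lt hs (by omega) (by omega) heq.symm
  rw [← Set.ncard_insert_of_notMem hnot (finite_cubeRoots _)]
  congr 1
  refine Set.Subset.antisymm (fun w hw => ?_) (Set.insert_subset
    (tribFactor_mem_cubeRoots (by omega) (by omega) le_rfl) (cubeRoots_mono (Nat.sub_le _ 1)))
  obtain ⟨k', s', -, hs, hn, he, rfl⟩ := exists_run_of_mem_cubeRoots hw
  rcases Nat.lt_or_ge (s' + 3 * tribAux (k' + 2)) (s + 3 * tribAux (k + 2)) with hlt | hge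
  · exact Or.inr (tribFactor_mem_cubeRoots hs he (by omega))
  · obtain rfl := huniq k' (by omega) (by omega)
    obtain rfl : s' = s := by omega
    exact Or.inl rfl

theorem runStart_add_three_mul (k : ℕ) :
    runStart k + 3 * tribAux (k + 2) = tribAux (k + 5) + 2 * tribAux (k + 2) := by
  rw [← runStart_add_tribAux]; omega

theorem C_zero : C 0 = 0 := by
  rw [C_eq_ncard, show cubeRoots 0 = ∅ from ?_, Set.ncard_empty]
  refine Set.eq_empty_of_forall_notMem fun w hw => ?_
  obtain ⟨h1, s, hs, -⟩ := mem_cubeRoots_iff.1 hw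
  omega

theorem t_mono {i j : ℤ} (h : i ≤ j) : t i ≤ t j := tribAux_mono (by omega)

theorem distinct_cubes_increments :
    C 0 = 0 ∧
    (∀ n : ℕ, 1 ≤ n → n ≤ 57 → C n = C (n - 1)) ∧
    (∀ n : ℕ, 58 ≤ n → ∀ m : ℤ,
      (t (m - 1) : ℤ) + 2 * (t (m - 4) : ℤ) ≤ (n : ℤ) →
      (n : ℤ) < (t m : ℤ) + 2 * (t (m - 3) : ℤ) →
      7 ≤ m ∧
      ((n : ℤ) ≤ (t (m - 1) : ℤ) + (kker (m + 1) : ℤ) - 2 → C n = C (n - 1) + 1) ∧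
      (¬((n : ℤ) ≤ (t (m - 1) : ℤ) + (kker (m + 1) : ℤ) - 2) → C n = C (n - 1))) := by
  refine ⟨C_zero, fun n _ hn => C_eq_of_forall fun k ⟨h1, h2⟩ => ?_, fun n hn m hm hm' => ?_⟩
  · have hk := three_le_of_two_mul_le_runLength (k := k) (by omega)
    rw [runStart_add_three_mul] at h1
    have h5 : tribAux 8 ≤ tribAux (k + 5) := tribAux_mono (by omega)
    have h6 : tribAux 5 ≤ tribAux (k + 2) := tribAux_mono (by omega)
    have h7 : tribAux 8 = 44 := by decide
    have h8 : tribAux 5 = 7 := by decide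
    omega
  · have hm7 : 7 ≤ m := by
      by_contra! hlt
      have h1 : t m ≤ t 6 := t_mono (by omega)
      have h2 : t (m - 3) ≤ t 3 := t_mono (by omega)
      have h3 : t 6 = 44 := by decide
      have h4 : t 3 = 7 := by decide
      omega
    obtain ⟨k, rfl⟩ : ∃ k : ℕ, m = k + 4 := ⟨(m - 4).toNat, by omega⟩
    have e1 : t ((k : ℤ) + 4 - 1) = tribAux (k + 5) := by rw [t]; congr 1; omega
    have e2 : t ((k : ℤ) + 4 - 4) = tribAux (k + 2) := by rw [t]; congr 1; omega
    have e3 : t ((k : ℤ) + 4) = tribAux (k + 6) := by rw [t]; congr 1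
    have e4 : t ((k : ℤ) + 4 - 3) = tribAux (k + 3) := by rw [t]; congr 1; omega
    have e5 : kker ((k : ℤ) + 4 + 1) = runLength k + 2 := by
      rw [← kAux_eq_runLength_add_two, kker]; congr 1
    rw [e1, e2] at hm
    rw [e3, e4] at hm'
    rw [e1, e5]
    have huniq : ∀ k', runStart k' + 3 * tribAux (k' + 2) ≤ n →
        n ≤ runStart k' + runLength k' + tribAux (k' + 2) → k' = k := by
      intro k' h1 h2
      rw [runStart_add_three_mul] at h1
      have h3 := runStart_add_tribAux k'
      rcases Nat.lt_trichotomy k' k with hlt | heq | hgt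
      · have h4 : tribAux (k' + 6) ≤ tribAux (k + 5) := tribAux_mono (by omega)
        have h5 : tribAux (k' + 3) ≤ tribAux (k + 2) := tribAux_mono (by omega)
        have h6 := runLength_add_two_le k'
        have h7 := tribAux_add_three (k' + 3)
        have h8 : tribAux (k' + 2) ≤ tribAux (k' + 3) := tribAux_mono (by omega)
        have h9 : tribAux (k' + 3) ≤ tribAux (k' + 4) := tribAux_mono (by omega)
        simp only [Nat.add_assoc, Nat.reduceAdd] at h7
        omega
      · exact heq
      · have h4 : tribAux (k + 6) ≤ tribAux (k' + 5) := tribAux_mono (by omega)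
        have h5 : tribAux (k + 3) ≤ tribAux (k' + 2) := tribAux_mono (by omega)
        omega
    have h1 := runStart_add_three_mul k
    have h2 := runStart_add_tribAux k
    refine ⟨hm7, fun hle => C_eq_add_one (k := k) (by omega) (by omega) huniq,
      fun hgt => C_eq_of_forall fun k' ⟨h3, h4⟩ => ?_⟩
    obtain rfl := huniq k' h3 h4
    omega
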